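/- Let $k$ be a field (of arbitrary characteristic), let $m, n, q$ be positive integers, and let $k[X]$ be the polynomial ring in the $mn$ variables $x_{i,j}$ ($1 \le i \le m$, $1 \le j \le n$). Let $I_2(X)$ be the ideal of $k[X]$ generated by the $2 \times 2$ minors $x_{i,j} x_{i',j'} - x_{i,j'} x_{i',j}$ for $i < i'$ and $j < j'$. Then the dimension of the $k$-vector space $k[X]/\left(I_2(X) + (x_{1,1}^q, \dots, x_{m,n}^q)\right)$ (i.e., the value at $q$ of the generalized Hilbert-Kunz function of $k[X]/I_2(X)$) equals $\sum_{i=1}^{n} (-1)^{n-i}\binom{n}{i}\binom{iq + m - 1}{m+n-1} \; + \; \sum_{i=1}^{n}\sum_{j=1}^{m} (-1)^{m-j+i-1}\binom{n}{i}\binom{m}{j}\binom{jq - iq + n - 1}{m+n-1}$. -/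

import Mathlib

open MvPolynomial

/-- Binomial coefficient of an integer `t` over a natural `b`, with the
convention that it is `0` whenever `t < b` (in particular whenever `t < 0`). -/
def ichoose (t : ℤ) (b : ℕ) : ℤ :=
  if t < (b : ℤ) then 0 else ((t.toNat.choose b : ℕ) : ℤ)

section Margins

variable {α β : Type*} [Fintype α] [Fintype β]

/-- The row sums and the column sums of a table of natural numbers. -/
def margins (e : α × β →₀ ℕ) : (α → ℕ) × (β → ℕ) :=
  (fun i => ∑ j, e (i, j), fun j => ∑ i, e (i, j))

@[simp] lemma margins_zero : margins (0 : α × β →₀ ℕ) = 0 := by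
  ext <;> simp [margins]

lemma margins_add (e f : α × β →₀ ℕ) : margins (e + f) = margins e + margins f := by
  ext <;> simp [margins, Finset.sum_add_distrib]

lemma margins_single [DecidableEq α] [DecidableEq β] (i : α) (j : β) (c : ℕ) :
    margins (Finsupp.single (i, j) c) = (Pi.single i c, Pi.single j c) := by
  ext x
  · by_cases h : i = x <;> simp [margins, Finsupp.single_apply, h, eq_comm]
  · by_cases h : j = x <;> simp [margins, Finsupp.single_apply, h, eq_comm]

lemma sum_margins_fst (e : α × β →₀ ℕ) : ∑ i, (margins e).1 i = ∑ j, (margins e).2 j :=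
  Finset.sum_comm

lemma eq_zero_of_sum_margins_eq_zero {e : α × β →₀ ℕ} (h : ∑ i, (margins e).1 i = 0) : e = 0 := by
  ext ⟨i, j⟩
  simp only [margins, Finset.sum_eq_zero_iff, Finset.mem_univ, true_implies] at h
  exact h i j

lemma exists_margins_eq (a : α → ℕ) (b : β → ℕ) (h : ∑ i, a i = ∑ j, b j) :
    ∃ e : α × β →₀ ℕ, margins e = (a, b) := by
  classical
  induction hd : ∑ i, a i generalizing a b with
  | zero =>
    refine ⟨0, ?_⟩
    rw [hd] at h
    simp only [Finset.sum_eq_zero_iff, Finset.mem_univ, true_implies] at hd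
    simp only [@eq_comm _ 0, Finset.sum_eq_zero_iff, Finset.mem_univ, true_implies] at h
    ext x
    · simp [hd]
    · simp [h]
  | succ d ih =>
    obtain ⟨i, -, hi⟩ := Finset.exists_ne_zero_of_sum_ne_zero (hd.trans_ne d.succ_ne_zero)
    obtain ⟨j, -, hj⟩ := Finset.exists_ne_zero_of_sum_ne_zero
      ((h.symm.trans hd).trans_ne d.succ_ne_zero)
    have ha : a = (a - Pi.single i 1) + Pi.single i 1 := by
      ext x; by_cases hx : x = i <;> simp [hx]; omega
    have hb : b = (b - Pi.single j 1) + Pi.single j 1 := by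
      ext x; by_cases hx : x = j <;> simp [hx]; omega
    generalize a - Pi.single i 1 = a' at ha
    generalize b - Pi.single j 1 = b' at hb
    subst ha hb
    simp only [Pi.add_apply, Finset.sum_add_distrib, Finset.sum_pi_single', Finset.mem_univ,
      if_true] at h hd
    obtain ⟨e, he⟩ := ih a' b' (by simpa using h) (by simpa using hd)
    exact ⟨e + Finsupp.single (i, j) 1, by rw [margins_add, he, margins_single]; rfl⟩

end Margins

section Monomials

variable {α β : Type*} [Fintype α] [Fintype β] {k : Type*} [CommRing k]
  {I : Ideal (MvPolynomial (α × β) k)}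

lemma monomial_sub_mem_add {σ : Type*} {I : Ideal (MvPolynomial σ k)} {e f : σ →₀ ℕ}
    (h : monomial e (1 : k) - monomial f 1 ∈ I) (g : σ →₀ ℕ) :
    monomial (e + g) (1 : k) - monomial (f + g) 1 ∈ I := by
  have := I.mul_mem_right (monomial g 1) h
  rwa [sub_mul, monomial_mul, monomial_mul, one_mul] at this

/-- A cell whose row and column are nonempty can be made nonzero modulo the `2 × 2` minors. -/
lemma exists_margins_eq_add_single
    (hI : ∀ i i' j j', X (i, j) * X (i', j') - X (i, j') * X (i', j) ∈ I)
    (e : α × β →₀ ℕ) {i : α} {j : β} (hi : (margins e).1 i ≠ 0) (hj : (margins e).2 j ≠ 0) :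
    ∃ f, margins (f + Finsupp.single (i, j) 1) = margins e ∧
      monomial (f + Finsupp.single (i, j) 1) (1 : k) - monomial e 1 ∈ I := by
  classical
  by_cases he : e (i, j) = 0
  · obtain ⟨j', -, hj'⟩ := Finset.exists_ne_zero_of_sum_ne_zero hi
    obtain ⟨i', -, hi'⟩ := Finset.exists_ne_zero_of_sum_ne_zero hj
    have hii : i' ≠ i := by rintro rfl; exact hi' he
    have hle : Finsupp.single (i, j') 1 + Finsupp.single (i', j) 1 ≤ e := by
      intro x
      simp only [Finsupp.add_apply, Finsupp.single_apply]
      split_ifs with h1 h2 h2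
      · exact absurd (congrArg Prod.fst (h2.trans h1.symm)) hii
      · subst h1; omega
      · subst h2; omega
      · omega
    obtain ⟨g, rfl⟩ := exists_add_of_le hle
    refine ⟨g + Finsupp.single (i', j') 1, ?_, ?_⟩
    · simp only [margins_add, margins_single]
      ext x <;> simp <;> ring
    · have := I.mul_mem_left (monomial g 1) (hI i i' j j')
      simp only [X, monomial_mul, mul_sub, one_mul] at this
      convert this using 4 <;> abel
  · have hle : Finsupp.single (i, j) 1 ≤ e := by
      rw [Finsupp.single_le_iff]; omega
    obtain ⟨g, rfl⟩ := exists_add_of_le hle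
    exact ⟨g, by rw [add_comm], by simp [add_comm g]⟩

lemma monomial_sub_mem_of_margins_eq
    (hI : ∀ i i' j j', X (i, j) * X (i', j') - X (i, j') * X (i', j) ∈ I)
    {e f : α × β →₀ ℕ} (h : margins e = margins f) :
    monomial e (1 : k) - monomial f 1 ∈ I := by
  classical
  induction hd : ∑ i, (margins e).1 i generalizing e f with
  | zero =>
    rw [eq_zero_of_sum_margins_eq_zero hd, eq_zero_of_sum_margins_eq_zero (e := f) (h ▸ hd), sub_self]
    exact I.zero_mem
  | succ d ih =>
    obtain ⟨i, -, hi⟩ := Finset.exists_ne_zero_of_sum_ne_zero (hd.trans_ne d.succ_ne_zero)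
    obtain ⟨j, -, hj⟩ := Finset.exists_ne_zero_of_sum_ne_zero
      (((sum_margins_fst e).symm.trans hd).trans_ne d.succ_ne_zero)
    obtain ⟨e', he, he'⟩ := exists_margins_eq_add_single hI e hi hj
    obtain ⟨f', hf, hf'⟩ := exists_margins_eq_add_single hI f (h ▸ hi) (h ▸ hj)
    have hef : margins e' = margins f' := by
      have := he.trans (h.trans hf.symm)
      rwa [margins_add, margins_add, add_left_inj] at this
    have hd' : ∑ i, (margins e').1 i = d := by
      rw [← he, margins_add, margins_single] at hd
      simpa [Finset.sum_add_distrib] using hd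
    have := monomial_sub_mem_add (ih hef hd') (Finsupp.single (i, j) 1)
    convert I.add_mem (I.sub_mem this he') hf' using 1
    ring

lemma exists_monomial_add_single_sub_mem
    (hI : ∀ i i' j j', X (i, j) * X (i', j') - X (i, j') * X (i', j) ∈ I)
    (q : ℕ) (e : α × β →₀ ℕ) {i : α} {j : β} (hi : q ≤ (margins e).1 i)
    (hj : q ≤ (margins e).2 j) :
    ∃ f, monomial (f + Finsupp.single (i, j) q) (1 : k) - monomial e 1 ∈ I := by
  classical
  induction q generalizing e with
  | zero => exact ⟨e, by simp⟩
  | succ q ih =>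
    obtain ⟨e', he, he'⟩ := exists_margins_eq_add_single hI e (i := i) (j := j)
      (by omega) (by omega)
    rw [← he, margins_add, margins_single] at hi hj
    obtain ⟨f, hf⟩ := ih e' (by simpa using hi) (by simpa using hj)
    refine ⟨f, ?_⟩
    have := I.add_mem (monomial_sub_mem_add hf (Finsupp.single (i, j) 1)) he'
    rw [Finsupp.single_add, ← add_assoc]
    convert this using 1
    ring

end Monomials

section Quotient

variable {α β : Type*} [LinearOrder α] [LinearOrder β]

lemma minor_mem_span {k : Type*} [CommRing k] (i i' : α) (j j' : β) :
    (X (i, j) * X (i', j') - X (i, j') * X (i', j) : MvPolynomial (α × β) k) ∈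
      Ideal.span {f | ∃ (i i' : α) (j j' : β), i < i' ∧ j < j' ∧
        f = X (i, j) * X (i', j') - X (i, j') * X (i', j)} := by
  set I := Ideal.span {f : MvPolynomial (α × β) k | ∃ (i i' : α) (j j' : β), i < i' ∧ j < j' ∧
        f = X (i, j) * X (i', j') - X (i, j') * X (i', j)}
  have key : ∀ (i i' : α) (j j' : β), i < i' → j < j' →
      (X (i, j) * X (i', j') - X (i, j') * X (i', j) : MvPolynomial (α × β) k) ∈ I :=
    fun i i' j j' hi hj => Ideal.subset_span ⟨i, i', j, j', hi, hj, rfl⟩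
  rcases lt_trichotomy i i' with hi | rfl | hi
  · rcases lt_trichotomy j j' with hj | rfl | hj
    · exact key _ _ _ _ hi hj
    · simp
    · convert I.neg_mem (key _ _ _ _ hi hj) using 1; ring
  · convert I.zero_mem using 1; ring
  · rcases lt_trichotomy j j' with hj | rfl | hj
    · convert I.neg_mem (key _ _ _ _ hi hj) using 1; ring
    · convert I.zero_mem using 1; ring
    · convert key _ _ _ _ hi hj using 1; ring

theorem finrank_quotient_minors_add_powers [Fintype α] [Fintype β] {k : Type*} [Field k] (q : ℕ)
    (S : Finset ((α → ℕ) × (β → ℕ)))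
    (hS : ∀ p, p ∈ S ↔ ∑ i, p.1 i = ∑ j, p.2 j ∧ ((∀ i, p.1 i < q) ∨ ∀ j, p.2 j < q)) :
    Module.finrank k (MvPolynomial (α × β) k ⧸
      (Ideal.span {f | ∃ (i i' : α) (j j' : β), i < i' ∧ j < j' ∧
        f = X (i, j) * X (i', j') - X (i, j') * X (i', j)} +
      Ideal.span {f : MvPolynomial (α × β) k | ∃ ij : α × β, f = X ij ^ q})) = S.card := by
  rw [Submodule.add_eq_sup, ← Ideal.span_union]
  set I := Ideal.span ({f | ∃ (i i' : α) (j j' : β), i < i' ∧ j < j' ∧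
        f = X (i, j) * X (i', j') - X (i, j') * X (i', j)} ∪
        {f : MvPolynomial (α × β) k | ∃ ij : α × β, f = X ij ^ q}) with hIdef
  have hI : ∀ i i' j j', X (i, j) * X (i', j') - X (i, j') * X (i', j) ∈ I :=
    fun i i' j j' => Ideal.span_mono Set.subset_union_left (minor_mem_span i i' j j')
  let v : (α × β →₀ ℕ) → (S →₀ k) := fun e =>
    if h : margins e ∈ S then Finsupp.single ⟨margins e, h⟩ 1 else 0
  let L : MvPolynomial (α × β) k →ₗ[k] (S →₀ k) := (basisMonomials (α × β) k).constr k v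
  have hL : ∀ e, L (monomial e 1) = v e := fun e => by
    have := (basisMonomials (α × β) k).constr_basis k v e
    rwa [coe_basisMonomials] at this
  have hLI : ∀ p ∈ I, ∀ r, L (r * p) = 0 := by
    intro p hp
    induction hp using Submodule.span_induction with
    | zero => simp
    | add x y _ _ hx hy => intro r; rw [mul_add, map_add, hx, hy, add_zero]
    | smul a x _ hx => intro r; rw [smul_eq_mul, ← mul_assoc, hx]
    | mem g hg =>
      intro r
      suffices L ∘ₗ LinearMap.mulRight k g = 0 from LinearMap.congr_fun this r
      refine (basisMonomials (α × β) k).ext fun e => ?_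
      simp only [coe_basisMonomials, LinearMap.comp_apply, LinearMap.mulRight_apply,
        LinearMap.zero_apply]
      rcases hg with ⟨i, i', j, j', -, -, rfl⟩ | ⟨⟨i, j⟩, rfl⟩
      · simp only [X, monomial_mul, mul_sub, one_mul, map_sub, hL, sub_eq_zero]
        have : margins (e + (Finsupp.single (i, j) 1 + Finsupp.single (i', j') 1)) =
            margins (e + (Finsupp.single (i, j') 1 + Finsupp.single (i', j) 1)) := by
          simp only [margins_add, margins_single]
          ext x
          · simp
          · simp [add_comm]
        simp only [v, this]
      · simp only [X_pow_eq_monomial, monomial_mul, one_mul, hL, v]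
        refine dif_neg fun h => ?_
        rw [hS, margins_add, margins_single] at h
        rcases h.2 with h | h
        · simpa using h i
        · simpa using h j
  have hex : ∀ s : S, ∃ e : α × β →₀ ℕ, margins e = s.1 := fun s =>
    exists_margins_eq _ _ ((hS _).1 s.2).1
  choose t ht using hex
  let P : MvPolynomial (α × β) k →ₗ[k] MvPolynomial (α × β) k ⧸ I :=
    (Ideal.Quotient.mkₐ k I).toLinearMap
  let G : (S →₀ k) →ₗ[k] MvPolynomial (α × β) k ⧸ I :=
    Finsupp.lift _ k S fun s => P (monomial (t s) 1)
  have hG : ∀ s, G (Finsupp.single s 1) = P (monomial (t s) 1) := fun s => by simp [G]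
  have hP : ∀ x y, x - y ∈ I → P x = P y := fun x y h => Ideal.Quotient.eq.2 h
  have hGL : G ∘ₗ L = P := by
    refine (basisMonomials (α × β) k).ext fun e => ?_
    simp only [coe_basisMonomials, LinearMap.comp_apply, hL, v]
    split_ifs with h
    · rw [hG]
      exact hP _ _ (monomial_sub_mem_of_margins_eq hI (ht _))
    · rw [map_zero]
      rw [hS] at h
      simp only [sum_margins_fst, true_and, not_or, not_forall, not_lt] at h
      obtain ⟨⟨i, hi⟩, j, hj⟩ := h
      obtain ⟨f, hf⟩ := exists_monomial_add_single_sub_mem hI q e hi hj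
      rw [← hP _ _ hf]
      refine (Ideal.Quotient.eq_zero_iff_mem.2 ?_).symm
      rw [← one_mul (1 : k), ← monomial_mul, ← X_pow_eq_monomial]
      exact I.mul_mem_left _ (Ideal.subset_span (Or.inr ⟨_, rfl⟩))
  have hker : LinearMap.ker L = I.restrictScalars k := by
    ext p
    rw [LinearMap.mem_ker, Submodule.restrictScalars_mem]
    refine ⟨fun h => Ideal.Quotient.eq_zero_iff_mem.1 ?_, fun h => by simpa using hLI p h 1⟩
    have := LinearMap.congr_fun hGL p
    rw [LinearMap.comp_apply, h, map_zero] at this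
    exact this.symm
  have hsurj : Function.Surjective L := by
    intro f
    induction f using Finsupp.induction_linear with
    | zero => exact ⟨0, map_zero L⟩
    | add f g hf hg =>
      obtain ⟨x, rfl⟩ := hf
      obtain ⟨y, rfl⟩ := hg
      exact ⟨x + y, map_add L x y⟩
    | single s c =>
      refine ⟨c • monomial (t s) 1, ?_⟩
      rw [map_smul, hL]
      simp [v, ht]
  have e1 : (MvPolynomial (α × β) k ⧸ I) ≃ₗ[k] (S →₀ k) :=
    (Submodule.Quotient.restrictScalarsEquiv k I).symm ≪≫ₗ
      (Submodule.quotEquivOfEq _ _ hker.symm) ≪≫ₗ L.quotKerEquivOfSurjective hsurj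
  rw [e1.finrank_eq, Module.finrank_finsupp_self, Fintype.card_coe]

end Quotient

section Counting

open Finset

lemma ichoose_natCast (t b : ℕ) : ichoose t b = t.choose b := by
  unfold ichoose
  split_ifs with h
  · rw [Nat.choose_eq_zero_of_lt (by exact_mod_cast h), Nat.cast_zero]
  · simp

lemma ite_forall_not_eq_sum {ι : Type*} (D : Finset ι) (p : ι → Prop) [DecidablePred p] :
    (if ∀ i ∈ D, ¬ p i then (1 : ℤ) else 0) =
      ∑ T ∈ D.powerset, (-1) ^ #T * if ∀ i ∈ T, p i then 1 else 0 := by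
  classical
  have h := prod_sub (fun _ => (1 : ℤ)) (fun i => if p i then 1 else 0) D
  simp only [prod_const_one, mul_one, prod_ite_zero] at h
  rw [← h, ← prod_const_one (s := D), ← prod_ite_zero]
  refine prod_congr rfl fun i _ => ?_
  by_cases hi : p i <;> simp [hi]

variable {ι : Type*} [Fintype ι] [DecidableEq ι]

lemma card_piAntidiag_univ [Nonempty ι] (s : ℕ) :
    #(piAntidiag (univ : Finset ι) s) =
      (s + Fintype.card ι - 1).choose (Fintype.card ι - 1) := by
  have hpos := Fintype.card_pos (α := ι)
  rw [← map_sym_eq_piAntidiag, card_map, sym_univ, card_univ, Sym.card_sym_eq_choose,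
    add_comm s, ← Nat.choose_symm (by omega)]
  congr 1
  omega

lemma card_piAntidiag_filter_le [Nonempty ι] (q s : ℕ) (T : Finset ι) :
    (#{f ∈ piAntidiag (univ : Finset ι) s | ∀ i ∈ T, q ≤ f i} : ℤ) =
      ichoose (s - q * #T + Fintype.card ι - 1) (Fintype.card ι - 1) := by
  have hpos := Fintype.card_pos (α := ι)
  let c : ι → ℕ := fun i => if i ∈ T then q else 0
  have hc : ∑ i, c i = q * #T := by simp [c, mul_comm]
  by_cases h : q * #T ≤ s
  · have himage : {f ∈ piAntidiag (univ : Finset ι) s | ∀ i ∈ T, q ≤ f i} =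
        (piAntidiag univ (s - q * #T)).map (addRightEmbedding c) := by
      ext f
      simp only [mem_filter, mem_piAntidiag, mem_univ, implies_true, and_true, mem_map,
        addRightEmbedding_apply]
      constructor
      · rintro ⟨hs, hf⟩
        have hle : c ≤ f := by
          intro i
          by_cases hi : i ∈ T <;> simp [c, hi, hf]
        obtain ⟨g, rfl⟩ := exists_add_of_le hle
        refine ⟨g, ?_, add_comm _ _⟩
        simp only [Pi.add_apply, sum_add_distrib, hc] at hs
        change ∑ i, g i = s - q * #T
        omega
      · rintro ⟨g, hg, rfl⟩
        refine ⟨?_, fun i hi => by simp [c, hi]⟩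
        simp only [Pi.add_apply, sum_add_distrib, hc, hg]
        omega
    rw [himage, card_map, card_piAntidiag_univ, ← ichoose_natCast]
    congr 1
    rw [Nat.cast_sub (by omega), Nat.cast_add, Nat.cast_sub h]
    push_cast
    ring
  · have hempty : {f ∈ piAntidiag (univ : Finset ι) s | ∀ i ∈ T, q ≤ f i} = ∅ := by
      rw [filter_eq_empty_iff]
      intro f hf hle
      rw [mem_piAntidiag] at hf
      have h1 : #T * q ≤ ∑ i ∈ T, f i := by
        simpa using card_nsmul_le_sum T f q hle
      have h2 := sum_le_univ_sum_of_nonneg (s := T) (f := f) (fun _ => Nat.zero_le _)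
      have h3 : ∑ i, f i = s := hf.1
      rw [mul_comm] at h1
      omega
    rw [hempty, card_empty, ichoose, if_pos, Nat.cast_zero]
    have : (s : ℤ) < q * #T := by exact_mod_cast not_le.1 h
    omega

lemma card_piAntidiag_filter_lt [Nonempty ι] (q s : ℕ) {D E : Finset ι} (h : Disjoint D E) :
    (#{f ∈ piAntidiag (univ : Finset ι) s | (∀ i ∈ D, f i < q) ∧ ∀ i ∈ E, f i < q} : ℤ) =
      ∑ i ∈ range (#D + 1), ∑ j ∈ range (#E + 1), (-1) ^ (i + j) * (#D).choose i * (#E).choose j *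
        ichoose (s - q * (i + j) + Fintype.card ι - 1) (Fintype.card ι - 1) := by
  have hind : ∀ f : ι → ℕ,
      (if (∀ i ∈ D, f i < q) ∧ ∀ i ∈ E, f i < q then (1 : ℤ) else 0) =
        ∑ T ∈ D.powerset, ∑ U ∈ E.powerset, (-1) ^ (#T + #U) *
          if ∀ i ∈ T ∪ U, q ≤ f i then 1 else 0 := by
    intro f
    simp only [← not_le]
    have hDE := congrArg₂ (· * ·) (ite_forall_not_eq_sum D fun i => q ≤ f i)
      (ite_forall_not_eq_sum E fun i => q ≤ f i)
    simp only [ite_zero_mul_ite_zero, mul_one, sum_mul_sum] at hDE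
    rw [hDE]
    refine sum_congr rfl fun T _ => sum_congr rfl fun U _ => ?_
    rw [pow_add, mul_mul_mul_comm, ite_zero_mul_ite_zero, mul_one]
    simp only [mem_union, or_imp, forall_and]
    congr!
  rw [natCast_card_filter]
  simp only [hind]
  rw [sum_comm]
  have hT : ∀ T ∈ D.powerset, ∑ f ∈ piAntidiag univ s, ∑ U ∈ E.powerset, (-1) ^ (#T + #U) *
      (if ∀ i ∈ T ∪ U, q ≤ f i then (1 : ℤ) else 0) = ∑ j ∈ range (#E + 1),
        (-1) ^ (#T + j) * (#E).choose j *
        ichoose (s - q * (#T + j) + Fintype.card ι - 1) (Fintype.card ι - 1) := by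
    intro T hT
    rw [sum_comm]
    calc _ = ∑ U ∈ E.powerset, (-1) ^ (#T + #U) *
        ichoose (s - q * (#T + #U) + Fintype.card ι - 1) (Fintype.card ι - 1) := by
          refine sum_congr rfl fun U hU => ?_
          rw [← mul_sum, ← natCast_card_filter, card_piAntidiag_filter_le, card_union_of_disjoint
            (h.mono (mem_powerset.1 hT) (mem_powerset.1 hU)), Nat.cast_add]
      _ = _ := by
          rw [sum_powerset_apply_card (fun j => (-1) ^ (#T + j) *
            ichoose (s - q * (#T + j) + Fintype.card ι - 1) (Fintype.card ι - 1))]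
          refine sum_congr rfl fun j _ => ?_
          rw [nsmul_eq_mul]
          ring
  rw [sum_congr rfl hT, sum_powerset_apply_card (fun i => ∑ j ∈ range (#E + 1),
        (-1) ^ (i + j) * ((#E).choose j : ℤ) *
        ichoose (s - q * (i + j) + Fintype.card ι - 1) (Fintype.card ι - 1))]
  refine sum_congr rfl fun i _ => ?_
  rw [nsmul_eq_mul, mul_sum]
  refine sum_congr rfl fun j _ => ?_
  ring

end Counting

section Pairs

open Finset

/-- Complementing the bounded component `a` to `q - 1 - a` turns the condition that both components
have the same sum into a condition on the total sum. -/
lemma exists_finset_pairs {α β : Type*} [Fintype α] [Fintype β] [DecidableEq α] [DecidableEq β]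
    (q : ℕ) (P : (β → ℕ) → Prop) [DecidablePred P] :
    ∃ S : Finset ((α → ℕ) × (β → ℕ)),
      (∀ p, p ∈ S ↔ ∑ i, p.1 i = ∑ j, p.2 j ∧ (∀ i, p.1 i < q) ∧ P p.2) ∧
      #S = #{f ∈ piAntidiag (univ : Finset (α ⊕ β)) (Fintype.card α * (q - 1)) |
        (∀ i, f (Sum.inl i) < q) ∧ P (f ∘ Sum.inr)} := by
  let flip : (α ⊕ β → ℕ) → (α → ℕ) × (β → ℕ) := fun f =>
    (fun i => q - 1 - f (Sum.inl i), f ∘ Sum.inr)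
  have hsum : ∀ a : α → ℕ, (∀ i, a i < q) →
      ∑ i, (q - 1 - a i) + ∑ i, a i = Fintype.card α * (q - 1) := by
    intro a ha
    rw [← sum_add_distrib, sum_congr rfl fun i _ => Nat.sub_add_cancel (Nat.le_sub_one_of_lt (ha i))]
    simp
  refine ⟨image flip {f ∈ piAntidiag (univ : Finset (α ⊕ β)) (Fintype.card α * (q - 1)) |
        (∀ i, f (Sum.inl i) < q) ∧ P (f ∘ Sum.inr)}, fun ⟨a, b⟩ => ?_, card_image_of_injOn ?_⟩
  · simp only [mem_image, mem_filter, mem_piAntidiag, mem_univ, implies_true, and_true,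
      Fintype.sum_sum_type, flip, Prod.mk.injEq]
    constructor
    · rintro ⟨f, ⟨hs, hf, hP⟩, rfl, rfl⟩
      have := hsum _ hf
      refine ⟨?_, fun i => ?_, hP⟩
      · simp only [Function.comp_apply]
        omega
      · have := hf i
        simp only
        omega
    · rintro ⟨hs, ha, hP⟩
      have := hsum _ ha
      refine ⟨Sum.elim (fun i => q - 1 - a i) b, ⟨?_, fun i => ?_, by simpa using hP⟩, ?_, by simp⟩
      · simp only [Sum.elim_inl, Sum.elim_inr]
        omega
      · have := ha i
        simp only [Sum.elim_inl]
        omega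
      · ext i
        have := ha i
        simp only [Sum.elim_inl]
        omega
  · intro f hf g hg hfg
    simp only [coe_filter, Set.mem_ofPred_eq] at hf hg
    simp only [flip, Prod.mk.injEq, funext_iff, Function.comp_apply] at hfg
    ext (i | j)
    · have h1 := hf.2.1 i
      have h2 := hg.2.1 i
      have h3 := hfg.1 i
      omega
    · exact hfg.2 j

lemma sum_range_succ_eq_add_sum_Icc_reflect (f : ℕ → ℤ) (m : ℕ) :
    ∑ i ∈ range (m + 1), f i = f m + ∑ i ∈ Icc 1 m, f (m - i) := by
  rw [← sum_range_reflect, add_tsub_cancel_right, range_eq_Ico, sum_eq_sum_Ico_succ_bot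
    (by omega)]
  rfl

lemma card_filter_inl_lt_inr_lt {m n q : ℕ} (hm : 0 < m) (hq : 0 < q) :
    (#{f ∈ piAntidiag (univ : Finset (Fin m ⊕ Fin n)) (m * (q - 1)) |
        (∀ i, f (Sum.inl i) < q) ∧ ∀ j, f (Sum.inr j) < q} : ℤ) =
      ∑ i ∈ Icc 1 m, ∑ j ∈ range (n + 1), (-1 : ℤ) ^ (m - i + j) * m.choose i * n.choose j *
          ichoose ((i : ℤ) * q - j * q + n - 1) (m + n - 1) := by
  have : Nonempty (Fin m ⊕ Fin n) := ⟨Sum.inl ⟨0, hm⟩⟩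
  have hdisj : Disjoint (univ.map (Function.Embedding.inl (α := Fin m) (β := Fin n)))
      (univ.map (Function.Embedding.inr (α := Fin m) (β := Fin n))) := by
    simp [disjoint_left]
  have h := card_piAntidiag_filter_lt q (m * (q - 1)) hdisj
  simp only [mem_map, mem_univ, true_and, Function.Embedding.inl_apply,
    Function.Embedding.inr_apply, forall_exists_index, forall_apply_eq_imp_iff, card_map,
    card_univ, Fintype.card_fin, Fintype.card_sum] at h
  rw [h, sum_range_succ_eq_add_sum_Icc_reflect, sum_eq_zero, zero_add]
  · refine sum_congr rfl fun i hi => sum_congr rfl fun j _ => ?_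
    rw [mem_Icc] at hi
    rw [Nat.choose_symm hi.2]
    congr 2
    push_cast [Nat.cast_sub hi.2, Nat.cast_pred hq]
    ring
  · intro j _
    rw [ichoose, if_pos, mul_zero]
    push_cast [Nat.cast_pred hq, Nat.cast_sub (show 1 ≤ m + n by omega)]
    nlinarith [mul_nonneg (Int.natCast_nonneg q) (Int.natCast_nonneg j)]

lemma card_filter_inl_lt {m n q : ℕ} (hm : 0 < m) (hq : 0 < q) :
    (#{f ∈ piAntidiag (univ : Finset (Fin m ⊕ Fin n)) (m * (q - 1)) |
        ∀ i, f (Sum.inl i) < q} : ℤ) =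
      ∑ i ∈ Icc 1 m, (-1 : ℤ) ^ (m - i) * (m.choose i : ℤ) *
          ichoose ((i : ℤ) * q + n - 1) (m + n - 1) := by
  have : Nonempty (Fin m ⊕ Fin n) := ⟨Sum.inl ⟨0, hm⟩⟩
  have h := card_piAntidiag_filter_lt q (m * (q - 1))
    (disjoint_empty_right (univ.map (Function.Embedding.inl (α := Fin m) (β := Fin n))))
  simp only [mem_map, mem_univ, true_and, Function.Embedding.inl_apply, forall_exists_index,
    forall_apply_eq_imp_iff, notMem_empty, false_imp_iff, implies_true, and_true, card_map,
    card_univ, Fintype.card_fin, card_empty, zero_add, range_one, sum_singleton, add_zero,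
    Nat.choose_self, Nat.cast_one, Nat.cast_zero, mul_one, Fintype.card_sum] at h
  rw [h, sum_range_succ_eq_add_sum_Icc_reflect, ichoose, if_pos, mul_zero, zero_add]
  · refine sum_congr rfl fun i hi => ?_
    rw [mem_Icc] at hi
    rw [Nat.choose_symm hi.2]
    congr 2
    push_cast [Nat.cast_sub hi.2, Nat.cast_pred hq]
    ring
  · push_cast [Nat.cast_pred hq, Nat.cast_sub (show 1 ≤ m + n by omega)]
    nlinarith

lemma exists_finset_margins (m n q : ℕ) (hm : 0 < m) (hn : 0 < n) (hq : 0 < q) :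
    ∃ S : Finset ((Fin m → ℕ) × (Fin n → ℕ)),
      (∀ p, p ∈ S ↔ ∑ i, p.1 i = ∑ j, p.2 j ∧ ((∀ i, p.1 i < q) ∨ ∀ j, p.2 j < q)) ∧
      (#S : ℤ) = (∑ i ∈ Icc 1 n, (-1 : ℤ) ^ (n - i) * (n.choose i : ℤ) *
          ichoose ((i : ℤ) * q + m - 1) (m + n - 1))
        + ∑ i ∈ Icc 1 n, ∑ j ∈ Icc 1 m,
            (-1 : ℤ) ^ (m - j + i - 1) * (n.choose i : ℤ) * (m.choose j : ℤ) *
              ichoose ((j : ℤ) * q - (i : ℤ) * q + n - 1) (m + n - 1) := by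
  obtain ⟨A, hA, hAcard⟩ := exists_finset_pairs (α := Fin n) (β := Fin m) q (fun _ => True)
  obtain ⟨B, hB, hBcard⟩ := exists_finset_pairs (α := Fin m) (β := Fin n) q
    (fun b => ¬ ∀ j, b j < q)
  have hdisj : Disjoint (A.map (Equiv.prodComm _ _).toEmbedding) B := by
    rw [disjoint_left]
    intro p hpA hpB
    rw [mem_map_equiv, hA] at hpA
    exact ((hB p).1 hpB).2.2 hpA.2.1
  refine ⟨A.map (Equiv.prodComm _ _).toEmbedding ∪ B, fun p => ?_, ?_⟩
  · rw [mem_union, mem_map_equiv, hA, hB, eq_comm]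
    simp only [Equiv.prodComm_symm, Equiv.prodComm_apply, Prod.fst_swap, Prod.snd_swap]
    tauto
  · rw [card_union_of_disjoint hdisj, card_map, hAcard, hBcard, Nat.cast_add]
    simp only [and_true, Fintype.card_fin, Function.comp_apply]
    rw [card_filter_inl_lt hn hq, add_comm n m]
    congr 1
    have hsplit := card_filter_add_card_filter_not
      (s := {f ∈ piAntidiag (univ : Finset (Fin m ⊕ Fin n)) (m * (q - 1)) |
        ∀ i, f (Sum.inl i) < q}) (fun f => ∀ j, f (Sum.inr j) < q)
    rw [filter_filter, filter_filter] at hsplit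
    have hsplit' := congrArg (Nat.cast : ℕ → ℤ) hsplit
    rw [Nat.cast_add, card_filter_inl_lt_inr_lt hm hq, card_filter_inl_lt hm hq,
      ← eq_sub_iff_add_eq', ← sum_sub_distrib] at hsplit'
    rw [hsplit', sum_comm]
    refine sum_congr rfl fun i _ => ?_
    rw [range_eq_Ico, sum_eq_sum_Ico_succ_bot (by omega)]
    simp only [Nat.cast_zero, zero_mul, sub_zero, add_zero, Nat.choose_zero_right, Nat.cast_one,
      mul_one, sub_add_cancel_left, zero_add, Ico_add_one_right_eq_Icc]
    rw [← sum_neg_distrib]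
    refine sum_congr rfl fun j hj => ?_
    obtain ⟨j, rfl⟩ := Nat.exists_eq_add_of_le' (mem_Icc.1 hj).1
    rw [← add_assoc, add_tsub_cancel_right, pow_succ]
    ring

end Pairs

theorem stmt_10 (k : Type*) [Field k] (m n q : ℕ) (hm : 0 < m) (hn : 0 < n) (hq : 0 < q)
    (I2 : Ideal (MvPolynomial (Fin m × Fin n) k))
    (hI2 : I2 = Ideal.span {f | ∃ (i i' : Fin m) (j j' : Fin n), i < i' ∧ j < j' ∧
      f = X (i, j) * X (i', j') - X (i, j') * X (i', j)})
    (J : Ideal (MvPolynomial (Fin m × Fin n) k))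
    (hJ : J = Ideal.span {f | ∃ ij : Fin m × Fin n, f = X ij ^ q}) :
    ((Module.finrank k (MvPolynomial (Fin m × Fin n) k ⧸ (I2 + J)) : ℕ) : ℤ)
      = (∑ i ∈ Finset.Icc 1 n, (-1 : ℤ) ^ (n - i) * (n.choose i : ℤ) *
          ichoose ((i : ℤ) * q + m - 1) (m + n - 1))
        + ∑ i ∈ Finset.Icc 1 n, ∑ j ∈ Finset.Icc 1 m,
            (-1 : ℤ) ^ (m - j + i - 1) * (n.choose i : ℤ) * (m.choose j : ℤ) *
              ichoose ((j : ℤ) * q - (i : ℤ) * q + n - 1) (m + n - 1) := by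
  obtain ⟨S, hS, hcard⟩ := exists_finset_margins m n q hm hn hq
  subst hI2 hJ
  rw [finrank_quotient_minors_add_powers q S hS, hcard]
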